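/- Let (A,β) be a braided Hopf algebra over a field k. Then for all a, b, b' ∈ A one has Σ β(b₁, a₁) β⁻¹(a₂, b₁') b₂ b₂' a₃ = Σ a₁ b₁ b₁' β(b₂, a₂) β⁻¹(a₃, b₂'), where β⁻¹ denotes the convolution inverse of β. (This is the commutation identity underlying the fact that ζ = m(m* ⊗ θ*) : U(A) ⋈ A^op → U(A ⋈ A) is a Hopf algebra map.) -/

import Mathlib

/-!
STATEMENT 11: Let (A,β) be a braided Hopf algebra over a field k.  Then for all a, b, b' ∈ A,
Σ β(b₁,a₁) β⁻¹(a₂,b₁') b₂ b₂' a₃ = Σ a₁ b₁ b₁' β(b₂,a₂) β⁻¹(a₃,b₂'),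
where β⁻¹ is the convolution inverse of β.  (The Sweedler sums are expressed via arbitrary
finite-sum representations of the (iterated) comultiplications of a, b and b'.)
-/

open TensorProduct Coalgebra LinearMap

noncomputable section

variable {k : Type} [Field k]

/-- Convolution product of linear maps from a coalgebra `C` to an algebra `M`:
`(f * g)(c) = Σ f(c₁) g(c₂)`. -/
def conv {C M : Type} [AddCommGroup C] [Module k C] [Coalgebra k C]
    [Ring M] [Algebra k M] (f g : C →ₗ[k] M) : C →ₗ[k] M :=
  (LinearMap.mul' k M) ∘ₗ (TensorProduct.map f g) ∘ₗ Coalgebra.comul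

/-- `Σ g(c₁) • f(c₂)`. -/
def convL {C M : Type} [AddCommGroup C] [Module k C] [Coalgebra k C]
    [AddCommGroup M] [Module k M] (g : C →ₗ[k] k) (f : C →ₗ[k] M) : C →ₗ[k] M :=
  (TensorProduct.lid k M).toLinearMap ∘ₗ (TensorProduct.map g f) ∘ₗ Coalgebra.comul

/-- `Σ g(c₂) • f(c₁)`. -/
def convR {C M : Type} [AddCommGroup C] [Module k C] [Coalgebra k C]
    [AddCommGroup M] [Module k M] (f : C →ₗ[k] M) (g : C →ₗ[k] k) : C →ₗ[k] M :=
  (TensorProduct.rid k M).toLinearMap ∘ₗ (TensorProduct.map f g) ∘ₗ Coalgebra.comul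

/-- Convolution invertibility of a bilinear form. -/
def IsConvInvertible {C : Type} [AddCommGroup C] [Module k C] [Coalgebra k C]
    (τ : C →ₗ[k] k) : Prop :=
  ∃ τi : C →ₗ[k] k, conv τ τi = Coalgebra.counit ∧ conv τi τ = Coalgebra.counit

/-- A skew pairing on the ordered pair `(A, U)`. -/
structure IsSkewPairing {A U : Type} [Ring A] [Ring U] [HopfAlgebra k A] [HopfAlgebra k U]
    (τ : A ⊗[k] U →ₗ[k] k) : Prop where
  mul_left : ∀ (b c : A) (u : U),
    τ ((b * c) ⊗ₜ u) = conv (τ ∘ₗ TensorProduct.mk k A U b) (τ ∘ₗ TensorProduct.mk k A U c) u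
  mul_right : ∀ (b : A) (u v : U),
    τ (b ⊗ₜ (u * v)) =
      conv (τ ∘ₗ (TensorProduct.mk k A U).flip v) (τ ∘ₗ (TensorProduct.mk k A U).flip u) b
  one_left : ∀ u : U, τ (1 ⊗ₜ u) = Coalgebra.counit u
  one_right : ∀ a : A, τ (a ⊗ₜ 1) = Coalgebra.counit a

/-- A braiding on a Hopf algebra `A`. -/
structure IsBraiding {A : Type} [Ring A] [HopfAlgebra k A] (β : A ⊗[k] A →ₗ[k] k) : Prop where
  skew : IsSkewPairing β
  invertible : IsConvInvertible β
  compat : ∀ a b : A,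
    convR ((LinearMap.mul' k A) ∘ₗ (TensorProduct.comm k A A).toLinearMap) β (a ⊗ₜ b)
      = convL β (LinearMap.mul' k A) (a ⊗ₜ b)

variable {A : Type} [Ring A] [HopfAlgebra k A]

section Convolution

open WithConv

variable {C M : Type} [AddCommGroup C] [Module k C] [Coalgebra k C] [Ring M] [Algebra k M]

theorem toConv_convL (g : C →ₗ[k] k) (f : C →ₗ[k] M) :
    toConv (convL g f) = toConv ((Algebra.linearMap k M) ∘ₗ g) * toConv f := by
  ext c
  simp [convL, (ℛ k c).convMul_apply, ← (ℛ k c).eq, Algebra.smul_def]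

theorem toConv_convR (f : C →ₗ[k] M) (g : C →ₗ[k] k) :
    toConv (convR f g) = toConv f * toConv ((Algebra.linearMap k M) ∘ₗ g) := by
  ext c
  simp [convR, (ℛ k c).convMul_apply, ← (ℛ k c).eq, Algebra.smul_def, Algebra.commutes]

theorem toConv_linearMap_comp_mul_eq_one {g h : C →ₗ[k] k} (hgh : conv g h = Coalgebra.counit) :
    toConv ((Algebra.linearMap k M) ∘ₗ g) * toConv ((Algebra.linearMap k M) ∘ₗ h) = 1 := by
  rw [LinearMap.convOne_def, ← hgh]
  ext c
  simp [conv, (ℛ k c).convMul_apply, ← (ℛ k c).eq]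

/-- Conjugating `f * g = g * f'` by the convolution inverse of the scalar map `g`. -/
theorem convL_inverse_eq_convR_inverse {f f' : C →ₗ[k] M} {g h : C →ₗ[k] k}
    (hgh : conv g h = Coalgebra.counit) (hhg : conv h g = Coalgebra.counit)
    (hf : convR f g = convL g f') : convL h f = convR f' h := by
  have hf := congrArg toConv hf
  rw [toConv_convL, toConv_convR] at hf
  apply toConv_injective
  rw [toConv_convL, toConv_convR]
  have hl := toConv_linearMap_comp_mul_eq_one (M := M) hhg
  have hr := toConv_linearMap_comp_mul_eq_one (M := M) hgh
  rw [← mul_one (toConv f), ← hr, ← mul_assoc (toConv f), hf, ← mul_assoc, ← mul_assoc, hl,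
    one_mul]

end Convolution

/-- The map `x ⊗ y ↦ φ x • (v * y)`. -/
def leftScaledMul (φ : A →ₗ[k] k) (v : A) : A ⊗[k] A →ₗ[k] A :=
  (TensorProduct.lid k A).toLinearMap ∘ₗ TensorProduct.map φ (mulLeft k v)

/-- The map `x ⊗ y ↦ φ y • (x * u)`. -/
def rightScaledMul (φ : A →ₗ[k] k) (u : A) : A ⊗[k] A →ₗ[k] A :=
  (TensorProduct.rid k A).toLinearMap ∘ₗ TensorProduct.map (mulRight k u) φ

@[simp]
theorem leftScaledMul_tmul (φ : A →ₗ[k] k) (v x y : A) :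
    leftScaledMul φ v (x ⊗ₜ y) = φ x • (v * y) := rfl

@[simp]
theorem rightScaledMul_tmul (φ : A →ₗ[k] k) (u x y : A) :
    rightScaledMul φ u (x ⊗ₜ y) = φ y • (x * u) := rfl

theorem sum_scaledMul_comul_of_convL_eq {ι : Type} {γ : A ⊗[k] A →ₗ[k] k} {b : A} {t : Finset ι}
    {b₁ b₂ : ι → A} (hb : Coalgebra.comul (R := k) b = ∑ j ∈ t, b₁ j ⊗ₜ[k] b₂ j)
    (h : ∀ a, convR ((mul' k A) ∘ₗ (TensorProduct.comm k A A).toLinearMap) γ (b ⊗ₜ a)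
      = convL γ (mul' k A) (b ⊗ₜ a)) :
    (∑ j ∈ t, leftScaledMul (γ ∘ₗ TensorProduct.mk k A A (b₁ j)) (b₂ j)) ∘ₗ Coalgebra.comul
      = (∑ j ∈ t, rightScaledMul (γ ∘ₗ TensorProduct.mk k A A (b₂ j)) (b₁ j))
        ∘ₗ Coalgebra.comul := by
  ext a
  have h := (h a).symm
  simp only [convL, convR, LinearMap.comp_apply, TensorProduct.comul_tmul, hb,
    ← (ℛ k a).eq, sum_tmul, tmul_sum, map_sum] at h
  simpa [← (ℛ k a).eq, LinearMap.sum_apply, Finset.sum_comm (s := t)] using h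

theorem sum_scaledMul_comul_of_convL_flip_eq {ι : Type} {γ : A ⊗[k] A →ₗ[k] k} {b : A}
    {t : Finset ι} {b₁ b₂ : ι → A}
    (hb : Coalgebra.comul (R := k) b = ∑ j ∈ t, b₁ j ⊗ₜ[k] b₂ j)
    (h : ∀ a, convL γ ((mul' k A) ∘ₗ (TensorProduct.comm k A A).toLinearMap) (a ⊗ₜ b)
      = convR (mul' k A) γ (a ⊗ₜ b)) :
    (∑ j ∈ t, leftScaledMul (γ ∘ₗ (TensorProduct.mk k A A).flip (b₁ j)) (b₂ j))
        ∘ₗ Coalgebra.comul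
      = (∑ j ∈ t, rightScaledMul (γ ∘ₗ (TensorProduct.mk k A A).flip (b₂ j)) (b₁ j))
        ∘ₗ Coalgebra.comul := by
  ext a
  have h := h a
  simp only [convL, convR, LinearMap.comp_apply, TensorProduct.comul_tmul, hb,
    ← (ℛ k a).eq, sum_tmul, tmul_sum, map_sum] at h
  simpa [← (ℛ k a).eq, LinearMap.sum_apply] using h

/-- If `G ∘ Δ = H ∘ Δ`, then `G` and `H` agree on the last two legs of `Δ₂`. -/
theorem sum_tmul_eq_of_comp_comul_eq {ι : Type} {a : A} {s : Finset ι} {a₁ a₂ a₃ : ι → A}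
    (ha : (rTensor A (Coalgebra.comul (R := k))) (Coalgebra.comul (R := k) a)
      = ∑ i ∈ s, (a₁ i ⊗ₜ[k] a₂ i) ⊗ₜ[k] a₃ i)
    {G H : A ⊗[k] A →ₗ[k] A} (h : G ∘ₗ Coalgebra.comul = H ∘ₗ Coalgebra.comul) :
    ∑ i ∈ s, a₁ i ⊗ₜ[k] G (a₂ i ⊗ₜ a₃ i) = ∑ i ∈ s, a₁ i ⊗ₜ[k] H (a₂ i ⊗ₜ a₃ i) := by
  have hl := congrArg (TensorProduct.assoc k A A A) ha
  rw [Coalgebra.coassoc_apply] at hl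
  have key := congrArg (fun f => lTensor A f (Coalgebra.comul (R := k) a)) h
  simp only [lTensor_comp, LinearMap.comp_apply] at key
  simpa [hl] using key

/-- If `G ∘ Δ = H ∘ Δ`, then `G` and `H` agree on the first two legs of `Δ₂`. -/
theorem sum_tmul_eq_of_comp_comul_eq' {ι : Type} {a : A} {s : Finset ι} {a₁ a₂ a₃ : ι → A}
    (ha : (rTensor A (Coalgebra.comul (R := k))) (Coalgebra.comul (R := k) a)
      = ∑ i ∈ s, (a₁ i ⊗ₜ[k] a₂ i) ⊗ₜ[k] a₃ i)
    {G H : A ⊗[k] A →ₗ[k] A} (h : G ∘ₗ Coalgebra.comul = H ∘ₗ Coalgebra.comul) :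
    ∑ i ∈ s, G (a₁ i ⊗ₜ a₂ i) ⊗ₜ[k] a₃ i = ∑ i ∈ s, H (a₁ i ⊗ₜ a₂ i) ⊗ₜ[k] a₃ i := by
  have key := congrArg (fun f => rTensor A f (Coalgebra.comul (R := k) a)) h
  simp only [rTensor_comp, LinearMap.comp_apply] at key
  simpa [ha] using key

/-- the commutation identity
`Σ β(b₁,a₁) β⁻¹(a₂,b₁') b₂ b₂' a₃ = Σ a₁ b₁ b₁' β(b₂,a₂) β⁻¹(a₃,b₂')`. -/
theorem braiding_commutation_identity (β : A ⊗[k] A →ₗ[k] k) (hβ : IsBraiding β)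
    (βi : A ⊗[k] A →ₗ[k] k)
    (hinv₁ : conv β βi = Coalgebra.counit) (hinv₂ : conv βi β = Coalgebra.counit) :
    ∀ (a b b' : A) (s t r : Finset ℕ) (a₁ a₂ a₃ b₁ b₂ b'₁ b'₂ : ℕ → A),
      -- Δ₂(a) = Σᵢ a₁ᵢ ⊗ a₂ᵢ ⊗ a₃ᵢ
      (LinearMap.rTensor A (Coalgebra.comul (R := k))) (Coalgebra.comul (R := k) a)
          = ∑ i ∈ s, (a₁ i ⊗ₜ[k] a₂ i) ⊗ₜ[k] a₃ i →
      -- Δ(b) = Σⱼ b₁ⱼ ⊗ b₂ⱼ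
      Coalgebra.comul (R := k) b = ∑ j ∈ t, b₁ j ⊗ₜ[k] b₂ j →
      -- Δ(b') = Σₗ b'₁ₗ ⊗ b'₂ₗ
      Coalgebra.comul (R := k) b' = ∑ l ∈ r, b'₁ l ⊗ₜ[k] b'₂ l →
      ∑ i ∈ s, ∑ j ∈ t, ∑ l ∈ r,
          (β (b₁ j ⊗ₜ a₁ i) * βi (a₂ i ⊗ₜ b'₁ l)) • (b₂ j * b'₂ l * a₃ i)
        = ∑ i ∈ s, ∑ j ∈ t, ∑ l ∈ r,
            (β (b₂ j ⊗ₜ a₂ i) * βi (a₃ i ⊗ₜ b'₂ l)) • (a₁ i * b₁ j * b'₁ l) := by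
  intro a b b' s t r a₁ a₂ a₃ b₁ b₂ b'₁ b'₂ ha hb hb'
  have hcompat : convR ((mul' k A) ∘ₗ (TensorProduct.comm k A A).toLinearMap) β
      = convL β (mul' k A) := TensorProduct.ext' hβ.compat
  have hflip := convL_inverse_eq_convR_inverse hinv₁ hinv₂ hcompat
  have h₁ := sum_scaledMul_comul_of_convL_eq hb fun a => hβ.compat b a
  have h₂ := sum_scaledMul_comul_of_convL_flip_eq hb' fun a => LinearMap.congr_fun hflip (a ⊗ₜ b')
  have e₂ := LinearMap.congr_arg (f := ∑ j ∈ t, leftScaledMul (β ∘ₗ TensorProduct.mk k A A (b₁ j)) (b₂ j))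
    (sum_tmul_eq_of_comp_comul_eq ha h₂)
  have e₁ := LinearMap.congr_arg
    (f := ∑ l ∈ r, rightScaledMul (βi ∘ₗ (TensorProduct.mk k A A).flip (b'₂ l)) (b'₁ l))
    (sum_tmul_eq_of_comp_comul_eq' ha h₁)
  simp only [map_sum, LinearMap.sum_apply, leftScaledMul_tmul, rightScaledMul_tmul,
    LinearMap.comp_apply, TensorProduct.mk_apply, LinearMap.flip_apply, Finset.mul_sum,
    Finset.sum_mul, Finset.smul_sum, mul_smul_comm, smul_mul_assoc, smul_smul,
    ← mul_assoc] at e₁ e₂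
  calc
    _ = _ := e₂
    _ = ∑ i ∈ s, ∑ l ∈ r, ∑ j ∈ t,
        (βi (a₃ i ⊗ₜ b'₂ l) * β (b₁ j ⊗ₜ a₁ i)) • (b₂ j * a₂ i * b'₁ l) := by
      refine Finset.sum_congr rfl fun i _ => ?_
      rw [Finset.sum_comm]
      simp only [mul_comm]
    _ = _ := e₁
    _ = _ := by
      refine Finset.sum_congr rfl fun i _ => ?_
      rw [Finset.sum_comm]
      simp only [mul_comm]

end
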